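/- Let p be a prime and let Γ_∞ be the Prüfer p-group, i.e., the subgroup {x ∈ ℚ/ℤ : p^n·x = 0 for some n ∈ ℕ} of ℚ/ℤ. Then the group cohomology of Γ_∞ with coefficients in the trivial representation on ℤ_p satisfies: H^n(Γ_∞; ℤ_p) ≅ ℤ_p for every even n ≥ 0, and H^n(Γ_∞; ℤ_p) = 0 for every odd n. -/

import Mathlib

/-- The group `ℚ/ℤ`, as the quotient of `ℚ` by its subgroup of integers. -/
abbrev QModZ : Type := ℚ ⧸ AddSubgroup.zmultiples (1 : ℚ)

/-- The Prüfer `p`-group `Γ_∞`: the subgroup `{x ∈ ℚ/ℤ : p^n·x = 0 for some n}` of `ℚ/ℤ`. -/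
def pruferSubgroup (p : ℕ) : AddSubgroup QModZ where
  carrier := {x | ∃ n : ℕ, p ^ n • x = 0}
  zero_mem' := ⟨0, smul_zero _⟩
  add_mem' := by
    rintro a b ⟨n, hn⟩ ⟨l, hl⟩
    refine ⟨n + l, ?_⟩
    have ha : p ^ (n + l) • a = 0 := by
      rw [add_comm n l, pow_add, mul_smul, hn, smul_zero]
    have hb : p ^ (n + l) • b = 0 := by rw [pow_add, mul_smul, hl, smul_zero]
    rw [smul_add, ha, hb, add_zero]
  neg_mem' := by
    rintro a ⟨n, hn⟩
    exact ⟨n, by rw [smul_neg, hn, neg_zero]⟩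

open CategoryTheory

section
variable {R G : Type} [CommRing R] [Group G]

def pdTail {n : ℕ} (f : (Fin n → G) → R) (g : Fin (n+1) → G) : R :=
  ∑ j : Fin (n+1), (-1 : R) ^ ((j : ℕ) + 1) * f (Fin.contractNth j (· * ·) g)

def pd {n : ℕ} (f : (Fin n → G) → R) (g : Fin (n+1) → G) : R :=
  f (fun i => g i.succ) + pdTail f g

theorem pd_eq {n : ℕ} (f : (Fin n → G) → R) :
    inhomogeneousCochains.d (Rep.trivial R G R) n f = pd f := by
  ext g
  rw [inhomogeneousCochains.d_hom_apply]
  simp [pd, pdTail]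

theorem pd_pd {n : ℕ} (f : (Fin n → G) → R) : pd (pd f) = 0 := by
  have h := groupCohomology.inhomogeneousCochains.d_comp_d n (Rep.trivial R G R)
  have h2 := congrArg (fun φ => φ.hom f) h
  simp only [ModuleCat.hom_comp, LinearMap.comp_apply] at h2
  rw [← pd_eq, ← pd_eq]
  exact h2

theorem pd_add {n : ℕ} (f f' : (Fin n → G) → R) : pd (f + f') = pd f + pd f' := by
  rw [← pd_eq, ← pd_eq, ← pd_eq]; exact map_add _ _ _
theorem pd_sub {n : ℕ} (f f' : (Fin n → G) → R) : pd (f - f') = pd f - pd f' := by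
  rw [← pd_eq, ← pd_eq, ← pd_eq]; exact map_sub _ _ _
theorem pd_smul {n : ℕ} (a : R) (f : (Fin n → G) → R) : pd (a • f) = a • pd f := by
  rw [← pd_eq, ← pd_eq]; exact map_smul _ _ _

theorem pdTail_smul {n : ℕ} (a : R) (f : (Fin n → G) → R) (x) :
    pdTail (fun y => a * f y) x = a * pdTail f x := by
  simp only [pdTail, Finset.mul_sum]
  exact Finset.sum_congr rfl fun _ _ => by ring

theorem pdTail_zero (f : (Fin 0 → G) → R) (x) : pdTail f x = - f Fin.elim0 := by
  simp only [pdTail, Fin.sum_univ_succ]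
  simp
  congr 1
  exact Subsingleton.elim _ _

theorem contract_succ {n : ℕ} (j : Fin (n+1)) (a : G) (x : Fin (n+1) → G) :
    Fin.contractNth j.succ (· * ·) (Fin.cons a x : Fin (n+2) → G)
      = Fin.cons a (Fin.contractNth j (· * ·) x) := by
  ext k
  refine Fin.cases ?_ (fun k => ?_) k
  · simp [Fin.contractNth]
  · simp [Fin.contractNth]

theorem contract_zero {n : ℕ} (a b : G) (x : Fin n → G) :
    Fin.contractNth 0 (· * ·) (Fin.cons a (Fin.cons b x : Fin (n+1) → G) : Fin (n+2) → G)
      = Fin.cons (a * b) x := by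
  ext k
  refine Fin.cases ?_ (fun k => ?_) k
  · simp [Fin.contractNth]
  · simp [Fin.contractNth]

theorem pdTail_cons {n : ℕ} (f : (Fin (n+1) → G) → R) (a b : G) (y : Fin n → G) :
    pdTail f (Fin.cons a (Fin.cons b y : Fin (n+1) → G)) =
      - f (Fin.cons (a * b) y) - pdTail (fun z => f (Fin.cons a z)) (Fin.cons b y) := by
  rw [pdTail, Fin.sum_univ_succ, contract_zero]
  simp only [contract_succ, pdTail]
  simp only [Fin.val_succ, pow_succ]
  simp [sub_eq_add_neg]

theorem pd_cons {n : ℕ} (f : (Fin n → G) → R) (a : G) (y : Fin n → G) :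
    pd f (Fin.cons a y) = f y + pdTail f (Fin.cons a y) := by
  simp [pd]

theorem pd_comp {H : Type} [Group H] (φ : H →* G) {n : ℕ} (f : (Fin n → G) → R) :
    pd (fun x : Fin n → H => f (fun i => φ (x i))) = fun x => pd f (fun i => φ (x i)) := by
  ext x
  simp only [pd, pdTail]
  congr 1
  refine Finset.sum_congr rfl fun j _ => ?_
  congr 2
  ext k
  simp only [Fin.contractNth]
  split_ifs <;> simp

noncomputable def cls {n : ℕ} (f : (Fin n → G) → R) (hf : pd f = 0) :
    groupCohomology (Rep.trivial R G R) n :=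
  groupCohomology.π _ n (groupCohomology.cocyclesMk (A := Rep.trivial R G R) f
    (by rw [pd_eq]; exact hf))

theorem cls_surj {n : ℕ} (x : groupCohomology (Rep.trivial R G R) n) :
    ∃ f, ∃ hf : pd f = 0, x = cls f hf := by
  induction x using groupCohomology_induction_on with
  | h x =>
    have hx : pd (groupCohomology.iCocycles (Rep.trivial R G R) n x) = 0 := by
      rw [← pd_eq]
      have := (groupCohomology.inhomogeneousCochains (Rep.trivial R G R)).iCycles_d n (n+1)
      rw [groupCohomology.inhomogeneousCochains.d_def] at this
      exact congrArg (fun φ => φ.hom x) this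
    refine ⟨groupCohomology.iCocycles (Rep.trivial R G R) n x, hx, ?_⟩
    rw [cls]
    congr 1
    apply (ModuleCat.mono_iff_injective (groupCohomology.iCocycles (Rep.trivial R G R) n)).1 inferInstance
    rw [groupCohomology.iCocycles_mk]

theorem cls_add {n : ℕ} (f f' : (Fin n → G) → R) (hf hf') :
    cls (f + f') (by rw [pd_add, hf, hf', add_zero]) = cls f hf + cls f' hf' := by
  rw [cls, cls, cls, ← map_add]
  congr 1
  apply (ModuleCat.mono_iff_injective (groupCohomology.iCocycles (Rep.trivial R G R) n)).1 inferInstance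
  rw [map_add, groupCohomology.iCocycles_mk, groupCohomology.iCocycles_mk, groupCohomology.iCocycles_mk]

theorem cls_smul {n : ℕ} (a : R) (f : (Fin n → G) → R) (hf) :
    cls (a • f) (by rw [pd_smul, hf, smul_zero]) = a • cls f hf := by
  rw [cls, cls, ← map_smul]
  congr 1
  apply (ModuleCat.mono_iff_injective (groupCohomology.iCocycles (Rep.trivial R G R) n)).1 inferInstance
  rw [map_smul, groupCohomology.iCocycles_mk, groupCohomology.iCocycles_mk]

theorem cls_eq_zero {n : ℕ} (f : (Fin (n+1) → G) → R) (hf) :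
    cls f hf = 0 ↔ ∃ h, pd h = f := by
  let K := groupCohomology.inhomogeneousCochains (Rep.trivial R G R)
  have hc := K.homologyIsCokernel n (n+1) (by simp)
  have hex := (ShortComplex.exact_of_g_is_cokernel
    (ShortComplex.mk (K.toCycles n (n+1)) (K.homologyπ (n+1)) (by simp)) hc)
  rw [ShortComplex.moduleCat_exact_iff] at hex
  have hi : ∀ h : (Fin n → G) → R, K.iCycles (n+1) (K.toCycles n (n+1) h) = pd h := by
    intro h
    have := K.toCycles_i n (n+1)
    rw [groupCohomology.inhomogeneousCochains.d_def] at this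
    rw [← pd_eq]
    exact congrArg (fun φ => φ.hom h) this
  constructor
  · intro h
    obtain ⟨y, hy⟩ := hex _ h
    refine ⟨y, ?_⟩
    rw [← hi]
    have := congrArg (K.iCycles (n+1)) hy
    exact this.trans (groupCohomology.iCocycles_mk (A := Rep.trivial R G R) _ _)
  · rintro ⟨h, rfl⟩
    have : K.toCycles n (n+1) h = groupCohomology.cocyclesMk (A := Rep.trivial R G R) (pd h) (by rw [pd_eq]; exact hf) := by
      apply (ModuleCat.mono_iff_injective (groupCohomology.iCocycles (Rep.trivial R G R) (n+1))).1 inferInstance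
      rw [groupCohomology.iCocycles_mk]
      exact hi h
    rw [cls, ← this]
    have h3 : K.toCycles n (n+1) ≫ K.homologyπ (n+1) = 0 := by simp
    exact congrArg (fun φ => φ.hom h) h3
end

section
variable {R G : Type} [CommRing R] [CommGroup G]

@[reducible] def dbl : ℕ → ℕ
  | 0 => 0
  | m+1 => dbl m + 2

theorem dbl_eq (m : ℕ) : dbl m = 2 * m := by
  induction m with
  | zero => rfl
  | succ m ih => rw [dbl, ih]; ring

/-- evaluation functional for a cyclic group of order `N` generated by `g` -/
def phi (g : G) (N : ℕ) : (m : ℕ) → ((Fin (dbl m) → G) → R) → R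
  | 0, f => f Fin.elim0
  | m+1, f => ∑ i ∈ Finset.range N,
      phi g N m (fun y => f (Fin.cons (g ^ i) (Fin.cons g y : Fin (dbl m + 1) → G)))

theorem phi_add (g : G) (N m : ℕ) (f f' : (Fin (dbl m) → G) → R) :
    phi g N m (fun y => f y + f' y) = phi g N m f + phi g N m f' := by
  induction m with
  | zero => rfl
  | succ m ih => simp only [phi, ih, Finset.sum_add_distrib]

theorem phi_smul (g : G) (N m : ℕ) (a : R) (f : (Fin (dbl m) → G) → R) :
    phi g N m (fun y => a * f y) = a * phi g N m f := by
  induction m with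
  | zero => rfl
  | succ m ih => simp only [phi, ih, Finset.mul_sum]

theorem phi_neg (g : G) (N m : ℕ) (f : (Fin (dbl m) → G) → R) :
    phi g N m (fun y => - f y) = - phi g N m f := by
  have := phi_smul g N m (-1) f
  simpa using this

theorem phi_sub (g : G) (N m : ℕ) (f f' : (Fin (dbl m) → G) → R) :
    phi g N m (fun y => f y - f' y) = phi g N m f - phi g N m f' := by
  simp only [sub_eq_add_neg, phi_add, phi_neg]

theorem phi_congr (g : G) (N m : ℕ) (f f' : (Fin (dbl m) → G) → R)
    (h : ∀ x, (∀ i, x i ∈ Subgroup.zpowers g) → f x = f' x) :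
    phi g N m f = phi g N m f' := by
  induction m with
  | zero => exact h _ (fun i => i.elim0)
  | succ m ih =>
    refine Finset.sum_congr rfl fun i _ => ih _ _ fun x hx => h _ ?_
    intro j
    refine Fin.cases ?_ (fun j => ?_) j
    · simp [Subgroup.npow_mem_zpowers]
    · refine Fin.cases ?_ (fun j => ?_) j
      · simp
      · simpa using hx j

theorem sum_shift (g : G) (N : ℕ) (hN : g ^ N = 1) (F : G → R) :
    ∑ i ∈ Finset.range N, F (g ^ i * g) = ∑ i ∈ Finset.range N, F (g ^ i) := by
  have h1 := Finset.sum_range_succ (fun i => F (g ^ i)) N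
  have h2 := Finset.sum_range_succ' (fun i => F (g ^ i)) N
  rw [h2] at h1
  simp only [pow_zero, hN, pow_succ] at h1
  exact add_right_cancel h1

theorem phi_pd_aux (g : G) (N : ℕ) (hN : g ^ N = 1) (m : ℕ) (h : (Fin (dbl m) → G) → R) :
    phi g N m (fun y => pd h (Fin.cons g y)) = 0 := by
  induction m with
  | zero =>
    simp only [phi, pd_cons]
    rw [pdTail_zero]; simp
  | succ m ih =>
    have key : ∀ i, phi g N m (fun y => pd h (Fin.cons g (Fin.cons (g ^ i)
          (Fin.cons g y : Fin (dbl m + 1) → G) : Fin (dbl m + 2) → G))) =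
        (phi g N m (fun y => h (Fin.cons (g ^ i) (Fin.cons g y : Fin (dbl m + 1) → G)))
        - phi g N m (fun y => h (Fin.cons (g ^ i * g) (Fin.cons g y : Fin (dbl m + 1) → G))))
        + (phi g N m (fun y => h (Fin.cons g (Fin.cons (g ^ i * g) y : Fin (dbl m + 1) → G)))
        - phi g N m (fun y => h (Fin.cons g (Fin.cons (g ^ i) y : Fin (dbl m + 1) → G)))) := by
      intro i
      have := ih (fun y => h (Fin.cons g (Fin.cons (g ^ i) y : Fin (dbl m + 1) → G)))
      simp only [pd_cons, phi_add] at this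
      simp only [pd_cons, pdTail_cons, phi_add, phi_sub, phi_neg]
      rw [mul_comm g (g ^ i)]
      linear_combination this
    show ∑ i ∈ Finset.range N, _ = _
    rw [Finset.sum_congr rfl fun i _ => key i, Finset.sum_add_distrib, Finset.sum_sub_distrib,
      Finset.sum_sub_distrib,
      sum_shift g N hN (fun z => phi g N m (fun y => h (Fin.cons z (Fin.cons g y : Fin (dbl m + 1) → G)))),
      sum_shift g N hN (fun z => phi g N m (fun y => h (Fin.cons g (Fin.cons z y : Fin (dbl m + 1) → G))))]
    simp

theorem phi_pd (g : G) (N : ℕ) (hN : g ^ N = 1) (m : ℕ) (h : (Fin (dbl m + 1) → G) → R) :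
    ∃ b : R, phi g N (m+1) (pd h) = N * b := by
  refine ⟨phi g N m (fun y => h (Fin.cons g y)), ?_⟩
  have key : ∀ i, phi g N m (fun y => pd h (Fin.cons (g ^ i)
          (Fin.cons g y : Fin (dbl m + 1) → G))) =
      phi g N m (fun y => h (Fin.cons g y)) +
       (phi g N m (fun y => h (Fin.cons (g ^ i) y))
       - phi g N m (fun y => h (Fin.cons (g ^ i * g) y))) := by
    intro i
    have := phi_pd_aux g N hN m (fun y => h (Fin.cons (g ^ i) y))
    simp only [pd_cons, phi_add] at this
    simp only [pd_cons, pdTail_cons, phi_add, phi_sub, phi_neg]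
    linear_combination -this
  show ∑ i ∈ Finset.range N, _ = _
  rw [Finset.sum_congr rfl fun i _ => key i, Finset.sum_add_distrib, Finset.sum_sub_distrib,
    sum_shift g N hN (fun z => phi g N m (fun y => h (Fin.cons z y)))]
  simp

/-- cup powers of a 2-cocycle -/
def cup (c : G → G → R) : (m : ℕ) → (Fin (dbl m) → G) → R
  | 0, _ => 1
  | m+1, x => c (x 0) (x 1) * cup c m (fun i => x i.succ.succ)

theorem cup_cons (c : G → G → R) (m : ℕ) (a b : G) (y : Fin (dbl m) → G) :
    cup c (m+1) (Fin.cons a (Fin.cons b y : Fin (dbl m + 1) → G)) = c a b * cup c m y := by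
  rfl

theorem pd_cup (c : G → G → R)
    (hc : ∀ a b z, c b z - c (a * b) z + c a (b * z) - c a b = 0) (m : ℕ) :
    pd (cup c m) = 0 := by
  induction m with
  | zero =>
    ext x
    simp only [pd, pdTail_zero]; simp [cup]
  | succ m ih =>
    ext x
    obtain ⟨a, x, rfl⟩ : ∃ a y, x = Fin.cons a y := ⟨_, _, (Fin.cons_self_tail x).symm⟩
    obtain ⟨b, x, rfl⟩ : ∃ a y, x = Fin.cons a y := ⟨_, _, (Fin.cons_self_tail x).symm⟩
    obtain ⟨z, w, rfl⟩ : ∃ a y, x = Fin.cons a y := ⟨_, _, (Fin.cons_self_tail x).symm⟩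
    have h := congrFun ih (Fin.cons z w)
    rw [pd_cons] at h
    rw [pd_cons, pdTail_cons, pdTail_cons]
    simp only [cup_cons, pdTail_smul]
    simp only [Pi.zero_apply] at h ⊢
    linear_combination (cup c m w) * hc a b z + c a b * h

theorem phi_cup (c : G → G → R) (g : G) (N : ℕ)
    (hs : ∑ i ∈ Finset.range N, c (g ^ i) g = 1) (m : ℕ) : phi g N m (cup c m) = 1 := by
  induction m with
  | zero => rfl
  | succ m ih =>
    simp only [phi, cup_cons, phi_smul, ih, mul_one, hs]

end

section
variable {R K : Type} [CommRing R] [CommGroup K] [Fintype K]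

theorem norm_triv (x : R) :
    (Rep.trivial R K R).norm.hom.toLinearMap x = (Fintype.card K : R) * x := by
  simp [Rep.norm, Representation.norm]

theorem piOdd_surj (A : Rep R K) (g : K) (hg : ∀ x, x ∈ Subgroup.zpowers g) (i : ℕ) (hi : Odd i) :
    Function.Surjective (Rep.FiniteCyclicGroup.groupCohomologyπOdd A g hg i hi).hom := by
  have h1 : Epi (ShortComplex.homologyπ (Rep.FiniteCyclicGroup.subCompNormHom A g)) := inferInstance
  have h2 : Epi (Rep.FiniteCyclicGroup.groupCohomologyIsoOdd A g hg i hi).inv := inferInstance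
  have h3 := epi_comp (ShortComplex.homologyπ (Rep.FiniteCyclicGroup.subCompNormHom A g))
    (Rep.FiniteCyclicGroup.groupCohomologyIsoOdd A g hg i hi).inv
  have h4 : Epi (ShortComplex.moduleCatCyclesIso (Rep.FiniteCyclicGroup.subCompNormHom A g)).inv :=
    inferInstance
  exact (ModuleCat.epi_iff_surjective _).1 (epi_comp' h4 h3)

theorem piEven_surj (A : Rep R K) (g : K) (hg : ∀ x, x ∈ Subgroup.zpowers g) (i : ℕ) [NeZero i]
    (hi : Even i) :
    Function.Surjective (Rep.FiniteCyclicGroup.groupCohomologyπEven A g hg i hi).hom := by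
  have h1 : Epi (ShortComplex.homologyπ (Rep.FiniteCyclicGroup.normHomCompSub A g)) := inferInstance
  have h2 : Epi (Rep.FiniteCyclicGroup.groupCohomologyIsoEven A g hg i hi).inv := inferInstance
  have h3 := epi_comp (ShortComplex.homologyπ (Rep.FiniteCyclicGroup.normHomCompSub A g))
    (Rep.FiniteCyclicGroup.groupCohomologyIsoEven A g hg i hi).inv
  have h4 : Epi (ShortComplex.moduleCatCyclesIso (Rep.FiniteCyclicGroup.normHomCompSub A g)).inv :=
    inferInstance
  exact (ModuleCat.epi_iff_surjective _).1 (epi_comp' h4 h3)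

theorem cyc_odd [IsDomain R] (g : K) (hg : ∀ x, x ∈ Subgroup.zpowers g)
    (hN : (Fintype.card K : R) ≠ 0) {n : ℕ} (hn : Odd (n+1)) (f : (Fin (n+1) → K) → R)
    (hf : pd f = 0) : ∃ h, pd h = f := by
  rw [← cls_eq_zero f hf]
  obtain ⟨⟨y, hy⟩, h⟩ := piOdd_surj (Rep.trivial R K R) g hg (n+1) hn (cls f hf)
  rw [← h]
  have hy' := LinearMap.mem_ker.1 hy
  rw [norm_triv] at hy'
  have : y = 0 := (mul_eq_zero.1 hy').resolve_left hN
  subst this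
  exact map_zero _

theorem even_psi (g : K) (hg : ∀ x, x ∈ Subgroup.zpowers g) {n : ℕ} (hn : Even (n+1)) :
    ∃ ψ : R →ₗ[R] groupCohomology (Rep.trivial R K R) (n+1), Function.Surjective ψ ∧
      ψ (Fintype.card K : R) = 0 := by
  have htop : ∀ x : R, x ∈ LinearMap.ker (Rep.applyAsHom (Rep.trivial R K R) g - 𝟙 _).hom.toLinearMap := by
    intro x
    rw [LinearMap.mem_ker]
    simp [Rep.sub_hom, Rep.applyAsHom]
  let ι : R →ₗ[R] LinearMap.ker (Rep.applyAsHom (Rep.trivial R K R) g - 𝟙 _).hom.toLinearMap :=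
    { toFun := fun x => ⟨x, htop x⟩
      map_add' := fun _ _ => rfl
      map_smul' := fun _ _ => rfl }
  refine ⟨(Rep.FiniteCyclicGroup.groupCohomologyπEven
      (Rep.trivial R K R) g hg (n+1) hn).hom.comp ι, ?_, ?_⟩
  · intro y
    obtain ⟨⟨x, hx⟩, h⟩ := piEven_surj (Rep.trivial R K R) g hg (n+1) hn y
    exact ⟨x, h⟩
  · refine (Rep.FiniteCyclicGroup.groupCohomologyπEven_eq_zero_iff (Rep.trivial R K R) g hg (n+1) hn
      (ι (Fintype.card K : R))).2 ⟨(1 : R), ?_⟩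
    exact (norm_triv 1).trans (mul_one _)

theorem cyc_even (g : K) (hg : ∀ x, x ∈ Subgroup.zpowers g)
    {n : ℕ} (hn : Even (n+1)) : ∃ U : (Fin (n+1) → K) → R, pd U = 0 ∧
      (∀ f : (Fin (n+1) → K) → R, pd f = 0 → ∃ c : R, ∃ h, f = c • U + pd h) ∧
      (∃ h, (Fintype.card K : R) • U = pd h) := by
  obtain ⟨ψ, hs, hz⟩ := even_psi (R := R) g hg hn
  obtain ⟨U, hU, hU'⟩ := cls_surj (ψ 1)
  have hψ : ∀ c : R, ψ c = cls (c • U) (by rw [pd_smul, hU]; simp) := by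
    intro c
    rw [cls_smul _ _ hU, ← hU', ← map_smul]; simp
  refine ⟨U, hU, ?_, ?_⟩
  · intro f hf
    obtain ⟨c, h⟩ := hs (cls f hf)
    have h2 : pd (f + (-1 : R) • (c • U)) = 0 := by
      rw [pd_add, pd_smul, pd_smul, hU, hf]; simp
    have h3 : cls (f + (-1 : R) • (c • U)) h2 = 0 := by
      rw [cls_add f _ hf (by rw [pd_smul, pd_smul, hU]; simp),
        cls_smul _ _ (by rw [pd_smul, hU]; simp), ← h, hψ]
      simp
    obtain ⟨k, hk⟩ := (cls_eq_zero _ _).1 h3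
    refine ⟨c, k, ?_⟩
    rw [hk]; simp
  · rw [hψ] at hz
    obtain ⟨k, hk⟩ := (cls_eq_zero _ _).1 hz
    exact ⟨k, hk.symm⟩

/-- A cocycle on a finite cyclic group with vanishing evaluation is a coboundary. -/
theorem cyc_phi (g : K) (hg : ∀ x, x ∈ Subgroup.zpowers g) (m : ℕ)
    (e : (Fin (dbl (m+1)) → K) → R) (he : pd e = 0) (he1 : phi g (Fintype.card K) (m+1) e = 1)
    (f : (Fin (dbl (m+1)) → K) → R) (hf : pd f = 0) (b : R)
    (hb : phi g (Fintype.card K) (m+1) f = (Fintype.card K : R) * b) :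
    ∃ h : (Fin (dbl m + 1) → K) → R, pd h = f := by
  have hev : Even (dbl m + 1 + 1) := by rw [dbl_eq]; exact ⟨m+1, by ring⟩
  obtain ⟨U, hU, h1, ⟨k, hk⟩⟩ := cyc_even (R := R) g hg hev
  have hN : g ^ Fintype.card K = 1 := pow_card_eq_one
  set N := Fintype.card K
  have lin : ∀ (a : R) (h : (Fin (dbl m + 1) → K) → R), ∃ d : R,
      phi g N (m+1) (a • U + pd h) = a * phi g N (m+1) U + N * d := by
    intro a h
    obtain ⟨d, hd⟩ := phi_pd g N hN m h
    refine ⟨d, ?_⟩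
    rw [← hd, ← phi_smul, ← phi_add]
    rfl
  obtain ⟨a, h, ha⟩ := h1 e he
  obtain ⟨a', h', ha'⟩ := h1 f hf
  obtain ⟨d, hd⟩ := lin a h
  obtain ⟨d', hd'⟩ := lin a' h'
  rw [← ha] at hd
  rw [← ha'] at hd'
  rw [he1] at hd
  rw [hb] at hd'
  refine ⟨(a * b - a * d' + a' * d) • k + h', ?_⟩
  rw [pd_add, pd_smul, ← hk, ha', smul_smul]
  congr 2
  linear_combination a * hd' - a' * hd
end

section
variable {R G : Type} [CommRing R] [CommGroup G]

/-- two cochains agree on a subgroup -/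
def AgreeOn {n : ℕ} (H : Subgroup G) (f f' : (Fin n → G) → R) : Prop :=
  ∀ x : Fin n → G, (∀ i, x i ∈ H) → f x = f' x

def resK {n : ℕ} (H : Subgroup G) (f : (Fin n → G) → R) : (Fin n → H) → R :=
  fun x => f (fun i => (x i : G))

theorem pd_resK {n : ℕ} (H : Subgroup G) (f : (Fin n → G) → R) :
    pd (resK H f) = resK H (pd f) := pd_comp H.subtype f

theorem agreeOn_iff {n : ℕ} (H : Subgroup G) (f f' : (Fin n → G) → R) :
    AgreeOn H f f' ↔ resK H f = resK H f' := by
  constructor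
  · intro h; ext x; exact h _ (fun i => (x i).2)
  · intro h x hx; exact congrFun h (fun i => ⟨x i, hx i⟩)

theorem resK_surj {n : ℕ} (H : Subgroup G) (h : (Fin n → H) → R) : ∃ h', resK H h' = h := by
  have hi : Function.Injective (fun (x : Fin n → H) (i : Fin n) => (x i : G)) := by
    intro x y hxy
    ext i; exact congrFun hxy i
  refine ⟨Function.extend (fun (x : Fin n → H) (i : Fin n) => (x i : G)) h 0, ?_⟩
  ext x
  exact hi.extend_apply h 0 x

theorem phi_resK (g : G) (N m : ℕ) (f : (Fin (dbl m) → G) → R) (H : Subgroup G) (hg : g ∈ H) :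
    phi (⟨g, hg⟩ : H) N m (resK H f) = phi g N m f := by
  induction m with
  | zero => simp only [phi, resK]; congr 1; ext i; exact i.elim0
  | succ m ih =>
    refine Finset.sum_congr rfl fun i _ => ?_
    rw [← ih]
    congr 1
    ext y
    simp only [resK]
    congr 1
    ext j
    refine Fin.cases ?_ (fun j => ?_) j
    · simp
    · refine Fin.cases ?_ (fun j => ?_) j
      · rfl
      · rfl

theorem loc_odd [IsDomain R] [CharZero R] (g : G) (hfin : IsOfFinOrder g) {n : ℕ}
    (hn : Odd (n+1)) (f : (Fin (n+1) → G) → R) (hf : AgreeOn (Subgroup.zpowers g) (pd f) 0) :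
    ∃ h, AgreeOn (Subgroup.zpowers g) (pd h) f := by
  have : Finite (Subgroup.zpowers g) := hfin.finite_zpowers
  have := Fintype.ofFinite (Subgroup.zpowers g)
  rw [agreeOn_iff, ← pd_resK] at hf
  obtain ⟨h, hh⟩ := cyc_odd (⟨g, Subgroup.mem_zpowers g⟩ : Subgroup.zpowers g)
    (by rintro ⟨x, i, rfl⟩; exact ⟨i, rfl⟩)
    (by exact_mod_cast Fintype.card_ne_zero) hn (resK _ f) hf
  obtain ⟨h', rfl⟩ := resK_surj _ h
  refine ⟨h', ?_⟩
  rw [agreeOn_iff, ← pd_resK, hh]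

theorem loc_even (g : G) (hfin : IsOfFinOrder g) (m : ℕ)
    (e : (Fin (dbl (m+1)) → G) → R) (he : pd e = 0) (he1 : phi g (orderOf g) (m+1) e = 1)
    (f : (Fin (dbl (m+1)) → G) → R) (hf : AgreeOn (Subgroup.zpowers g) (pd f) 0) (b : R)
    (hb : phi g (orderOf g) (m+1) f = (orderOf g : R) * b) :
    ∃ h : (Fin (dbl m + 1) → G) → R, AgreeOn (Subgroup.zpowers g) (pd h) f := by
  have : Finite (Subgroup.zpowers g) := hfin.finite_zpowers
  have := Fintype.ofFinite (Subgroup.zpowers g)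
  have hc : Fintype.card (Subgroup.zpowers g) = orderOf g := by
    rw [← Nat.card_eq_fintype_card, Nat.card_zpowers]
  rw [agreeOn_iff, ← pd_resK] at hf
  obtain ⟨h, hh⟩ := cyc_phi (⟨g, Subgroup.mem_zpowers g⟩ : Subgroup.zpowers g)
    (by rintro ⟨x, i, rfl⟩; exact ⟨i, rfl⟩) m (resK _ e) (by rw [pd_resK, he]; rfl)
    (by rw [phi_resK, hc, he1]) (resK _ f) hf b (by rw [phi_resK, hc, hb])
  obtain ⟨h', rfl⟩ := resK_surj _ h
  refine ⟨h', ?_⟩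
  rw [agreeOn_iff, ← pd_resK, hh]

/-- gluing -/
theorem glue (H : ℕ → Subgroup G) (hmono : Monotone H) (hex : ∀ x, ∃ k, x ∈ H k) {n : ℕ}
    (f : (Fin (n+1) → G) → R)
    (h1 : ∀ k, ∃ g, AgreeOn (H k) (pd g) f)
    (h2 : ∀ k (z : (Fin n → G) → R), AgreeOn (H k) (pd z) 0 → ∃ w, pd w = 0 ∧ AgreeOn (H k) w z) :
    ∃ g, pd g = f := by
  have step : ∀ k (g : {g : (Fin n → G) → R // AgreeOn (H k) (pd g) f}),
      ∃ g' : {g : (Fin n → G) → R // AgreeOn (H (k+1)) (pd g) f}, AgreeOn (H k) g'.1 g.1 := by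
    rintro k ⟨g, hg⟩
    obtain ⟨g0, hg0⟩ := h1 (k+1)
    obtain ⟨w, hw, hw'⟩ := h2 k (g0 - g) (by
      intro x hx
      rw [pd_sub]
      simp only [Pi.sub_apply, Pi.zero_apply]
      rw [hg x hx, hg0 x (fun i => hmono (Nat.le_succ k) (hx i)), sub_self])
    refine ⟨⟨g0 - w, ?_⟩, ?_⟩
    · rw [pd_sub, hw, sub_zero]; exact hg0
    · intro x hx
      have := hw' x hx
      simp only [Pi.sub_apply] at this ⊢
      rw [this]; ring
  choose nxt hnxt using step
  let s : (k : ℕ) → {g : (Fin n → G) → R // AgreeOn (H k) (pd g) f} :=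
    fun k => Nat.rec ⟨(h1 0).choose, (h1 0).choose_spec⟩ (fun k g => nxt k g) k
  have hs : ∀ k l, k ≤ l → AgreeOn (H k) (s l).1 (s k).1 := by
    intro k l hkl
    induction l, hkl using Nat.le_induction with
    | base => intro x _; rfl
    | succ l hl ih =>
      intro x hx
      rw [← ih x hx]
      exact hnxt l (s l) x (fun i => hmono hl (hx i))
  have hex' : ∀ (n : ℕ) (x : Fin n → G), ∃ k, ∀ i, x i ∈ H k := by
    intro n x
    choose κ hκ using fun i => hex (x i)
    exact ⟨Finset.univ.sup κ, fun i => hmono (Finset.le_sup (Finset.mem_univ i)) (hκ i)⟩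
  choose κ hκ using hex' n
  refine ⟨fun x => (s (κ x)).1 x, ?_⟩
  have hag : ∀ k, AgreeOn (H k) (fun x => (s (κ x)).1 x) (s k).1 := by
    intro k x hx
    rcases le_total k (κ x) with h | h
    · exact hs _ _ h x hx
    · exact (hs _ _ h x (hκ x)).symm
  ext x
  obtain ⟨k, hk⟩ := hex' (n+1) x
  rw [← (s k).2 x hk]
  have := (agreeOn_iff _ _ _).1 (hag k)
  have h3 := congrArg pd this
  rw [pd_resK, pd_resK] at h3
  exact (agreeOn_iff _ _ _).2 h3 x hk
end

section
variable {p : ℕ} [Fact p.Prime]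

theorem padic_zero (a : ℤ_[p]) (h : ∀ k : ℕ, ∃ b : ℤ_[p], a = ((p ^ (k+1) : ℕ) : ℤ_[p]) * b) :
    a = 0 := by
  have : ∀ x ∈ (⊤ : Ideal ℤ_[p]), True := fun _ _ => trivial
  refine IsHausdorff.haus (I := IsLocalRing.maximalIdeal ℤ_[p]) inferInstance a fun k => ?_
  obtain ⟨b, hb⟩ := h k
  rw [SModEq.zero, smul_eq_mul, Ideal.mul_top, PadicInt.maximalIdeal_eq_span_p,
    Ideal.span_singleton_pow, Ideal.mem_span_singleton, hb]
  refine ⟨p * b, ?_⟩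
  push_cast; ring

theorem padic_lim (a : ℕ → ℤ_[p])
    (h : ∀ k : ℕ, ∃ b : ℤ_[p], a k - a (k+1) = ((p ^ (k+1) : ℕ) : ℤ_[p]) * b) :
    ∃ L, ∀ k : ℕ, ∃ b : ℤ_[p], a k - L = ((p ^ (k+1) : ℕ) : ℤ_[p]) * b := by
  have key : ∀ (k : ℕ) (x y : ℤ_[p]), x ≡ y [SMOD (IsLocalRing.maximalIdeal ℤ_[p] ^ k •
      (⊤ : Submodule ℤ_[p] ℤ_[p]))] ↔ ∃ b : ℤ_[p], x - y = ((p ^ k : ℕ) : ℤ_[p]) * b := by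
    intro k x y
    rw [SModEq.sub_mem, smul_eq_mul, Ideal.mul_top, PadicInt.maximalIdeal_eq_span_p,
      Ideal.span_singleton_pow, Ideal.mem_span_singleton]
    push_cast
    rfl
  have hstep : ∀ m n, m ≤ n → ∃ b : ℤ_[p], a m - a n = ((p ^ (m+1) : ℕ) : ℤ_[p]) * b := by
    intro m n hmn
    induction n, hmn using Nat.le_induction with
    | base => exact ⟨0, by simp⟩
    | succ n hn ih =>
      obtain ⟨b, hb⟩ := ih
      obtain ⟨b', hb'⟩ := h n
      obtain ⟨d, rfl⟩ := Nat.exists_eq_add_of_le hn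
      refine ⟨b + p ^ d * b', ?_⟩
      push_cast at *
      linear_combination hb + hb'
  obtain ⟨L, hL⟩ := IsPrecomplete.prec (I := IsLocalRing.maximalIdeal ℤ_[p]) (M := ℤ_[p])
    inferInstance (f := fun n => a (n - 1)) (by
      intro m n hmn
      rw [key]
      rcases m with _ | m
      · exact ⟨a (0 - 1) - a (n - 1), by simp⟩
      · exact hstep _ _ (by omega))
  refine ⟨L, fun k => ?_⟩
  have := (key _ _ _).1 (hL (k+1))
  simpa using this

variable {G : Type} [CommGroup G]

theorem fin_ord (γ : ℕ → G) (hord : ∀ k, orderOf (γ k) = p ^ (k+1)) (k : ℕ) : IsOfFinOrder (γ k) := by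
  rw [← orderOf_pos_iff, hord]
  exact pow_pos (Fact.out : p.Prime).pos _

theorem zmono (γ : ℕ → G) (hsucc : ∀ k, γ k ∈ Subgroup.zpowers (γ (k+1))) : Monotone (fun k => Subgroup.zpowers (γ k)) :=
  monotone_nat_of_le_succ fun k => by
    rw [Subgroup.zpowers_le]; exact hsucc k

theorem abs_odd (γ : ℕ → G) (hord : ∀ k, orderOf (γ k) = p ^ (k+1))
    (hsucc : ∀ k, γ k ∈ Subgroup.zpowers (γ (k+1))) (hex : ∀ x, ∃ k, x ∈ Subgroup.zpowers (γ k))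
    (c : G → G → ℤ_[p]) (hc : ∀ a b z, c b z - c (a * b) z + c a (b * z) - c a b = 0)
    (hsum : ∀ k, ∑ i ∈ Finset.range (p ^ (k+1)), c (γ k ^ i) (γ k) = 1)
    (m : ℕ) (f : (Fin (dbl m + 1) → G) → ℤ_[p]) (hf : pd f = 0) : ∃ g, pd g = f := by
  refine glue (fun k => Subgroup.zpowers (γ k)) (zmono γ hsucc) hex f ?_ ?_
  · intro k
    refine loc_odd (γ k) (fin_ord γ hord k) (by rw [dbl_eq]; exact ⟨m, rfl⟩) f ?_
    rw [hf]; intro x _; rfl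
  · intro k z hz
    rcases m with _ | m
    · refine ⟨z, ?_, fun x _ => rfl⟩
      ext x
      simp only [pd, pdTail_zero, Pi.zero_apply]
      rw [Subsingleton.elim (fun i : Fin 0 => x i.succ) Fin.elim0]; ring
    · have he := pd_cup c hc (m+1)
      have he1 := phi_cup c (γ k) (p ^ (k+1)) (hsum k) (m+1)
      obtain ⟨h, hh⟩ := loc_even (γ k) (fin_ord γ hord k) m (cup c (m+1)) he (by rw [hord, he1])
        (z - (phi (γ k) (p ^ (k+1)) (m+1) z) • cup c (m+1)) (by
          rw [pd_sub, pd_smul, he, smul_zero, sub_zero]; exact hz) 0 (by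
          rw [hord, mul_zero]
          refine (phi_sub _ _ _ z (fun y => _ * cup c (m+1) y)).trans ?_
          rw [phi_smul, he1]; ring)
      refine ⟨(phi (γ k) (p ^ (k+1)) (m+1) z) • cup c (m+1) + pd h, ?_, ?_⟩
      · rw [pd_add, pd_pd, pd_smul, he]; simp
      · intro x hx
        have := hh x hx
        simp only [Pi.add_apply, Pi.sub_apply] at this ⊢
        rw [this]; ring

theorem abs_even (γ : ℕ → G) (hord : ∀ k, orderOf (γ k) = p ^ (k+1))
    (hsucc : ∀ k, γ k ∈ Subgroup.zpowers (γ (k+1))) (hex : ∀ x, ∃ k, x ∈ Subgroup.zpowers (γ k))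
    (c : G → G → ℤ_[p]) (hc : ∀ a b z, c b z - c (a * b) z + c a (b * z) - c a b = 0)
    (hsum : ∀ k, ∑ i ∈ Finset.range (p ^ (k+1)), c (γ k ^ i) (γ k) = 1)
    (m : ℕ) (f : (Fin (dbl (m+1)) → G) → ℤ_[p]) (hf : pd f = 0) :
    ∃ a : ℤ_[p], ∃ g : (Fin (dbl m + 1) → G) → ℤ_[p], f = a • cup c (m+1) + pd g := by
  have he := pd_cup c hc (m+1)
  have he1 := fun k => phi_cup c (γ k) (p ^ (k+1)) (hsum k) (m+1)
  have hphi : ∀ k (a : ℤ_[p]), phi (γ k) (p ^ (k+1)) (m+1) (f - a • cup c (m+1)) =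
      phi (γ k) (p ^ (k+1)) (m+1) f - a := by
    intro k a
    refine (phi_sub _ _ _ f (fun y => _ * cup c (m+1) y)).trans ?_
    rw [phi_smul, he1]; ring
  have hco : ∀ a : ℤ_[p], pd (f - a • cup c (m+1)) = 0 := by
    intro a; rw [pd_sub, pd_smul, he, hf]; simp
  have hloc : ∀ k (a b : ℤ_[p]), phi (γ k) (p ^ (k+1)) (m+1) f - a = ((p ^ (k+1) : ℕ) : ℤ_[p]) * b →
      ∃ h : (Fin (dbl m + 1) → G) → ℤ_[p],
        AgreeOn (Subgroup.zpowers (γ k)) (pd h) (f - a • cup c (m+1)) := by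
    intro k a b hb
    refine loc_even (γ k) (fin_ord γ hord k) m (cup c (m+1)) he (by rw [hord, he1]) _
      (by rw [hco]; intro x _; rfl) b ?_
    rw [hord, hphi, hb]
  obtain ⟨a, ha⟩ := padic_lim (fun k => phi (γ k) (p ^ (k+1)) (m+1) f) (by
    intro k
    obtain ⟨h, hh⟩ := hloc (k+1) (phi (γ (k+1)) (p ^ (k+1+1)) (m+1) f) 0 (by simp)
    obtain ⟨b, hb⟩ := phi_pd (γ k) (p ^ (k+1)) (by rw [← hord]; exact pow_orderOf_eq_one _) m h
    refine ⟨b, ?_⟩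
    rw [← hb, ← hphi]
    exact (phi_congr (γ k) (p ^ (k+1)) (m+1) _ _ fun x hx => hh x fun i => zmono γ hsucc (Nat.le_succ k) (hx i)).symm)
  obtain ⟨g, hg⟩ := glue (fun k => Subgroup.zpowers (γ k)) (zmono γ hsucc) hex
    (f - a • cup c (m+1)) (by
      intro k
      obtain ⟨b, hb⟩ := ha k
      exact hloc k a b hb) (by
      intro k z hz
      obtain ⟨h, hh⟩ := loc_odd (γ k) (fin_ord γ hord k) (by rw [dbl_eq]; exact ⟨m, rfl⟩) z hz
      exact ⟨pd h, pd_pd h, hh⟩)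
  exact ⟨a, g, by rw [hg]; abel⟩

theorem abs_main (γ : ℕ → G) (hord : ∀ k, orderOf (γ k) = p ^ (k+1))
    (hsucc : ∀ k, γ k ∈ Subgroup.zpowers (γ (k+1))) (hex : ∀ x, ∃ k, x ∈ Subgroup.zpowers (γ k))
    (c : G → G → ℤ_[p]) (hc : ∀ a b z, c b z - c (a * b) z + c a (b * z) - c a b = 0)
    (hsum : ∀ k, ∑ i ∈ Finset.range (p ^ (k+1)), c (γ k ^ i) (γ k) = 1)
    :
    (∀ n : ℕ, Even n → Nonempty
      ((groupCohomology (Rep.trivial ℤ_[p] G ℤ_[p]) n) ≃ₗ[ℤ_[p]] ℤ_[p])) ∧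
    (∀ n : ℕ, Odd n → Subsingleton
      (groupCohomology (Rep.trivial ℤ_[p] G ℤ_[p]) n)) := by
  constructor
  · rintro n ⟨m, hm⟩
    obtain rfl : n = dbl m := by rw [dbl_eq]; omega
    rcases m with _ | m
    · have e1 := (groupCohomology.H0Iso (Rep.trivial ℤ_[p] G ℤ_[p])).toLinearEquiv
      have e2 : (Rep.trivial ℤ_[p] G ℤ_[p]).ρ.invariants = ⊤ := by
        ext x; simp [Representation.mem_invariants]
      exact ⟨e1.trans ((LinearEquiv.ofEq _ _ e2).trans Submodule.topEquiv)⟩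
    · have he := pd_cup c hc (m+1)
      refine ⟨(LinearEquiv.ofBijective
        (LinearMap.toSpanSingleton ℤ_[p] _ (cls (cup c (m+1)) he)) ⟨?_, ?_⟩).symm⟩
      · rw [injective_iff_map_eq_zero]
        intro a ha
        rw [LinearMap.toSpanSingleton_apply, ← cls_smul] at ha
        obtain ⟨h, hh⟩ := (cls_eq_zero (n := dbl m + 1) _ _).1 ha
        refine padic_zero a fun k => ?_
        obtain ⟨b, hb⟩ := phi_pd (γ k) (p ^ (k+1)) (by rw [← hord]; exact pow_orderOf_eq_one _) m h
        refine ⟨b, ?_⟩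
        rw [← hb, hh]
        refine ((phi_smul _ _ _ a (cup c (m+1))).trans ?_).symm
        rw [phi_cup c (γ k) (p ^ (k+1)) (hsum k) (m+1), mul_one]
      · intro x
        obtain ⟨f, hf, rfl⟩ := cls_surj x
        obtain ⟨a, g, rfl⟩ := abs_even γ hord hsucc hex c hc hsum m f hf
        refine ⟨a, ?_⟩
        rw [LinearMap.toSpanSingleton_apply, ← cls_smul,
          cls_add _ _ (by rw [pd_smul, he, smul_zero]) (pd_pd g)]
        rw [(cls_eq_zero (n := dbl m + 1) (pd g) (pd_pd g)).2 ⟨g, rfl⟩, add_zero]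
  · rintro n ⟨m, hm⟩
    obtain rfl : n = dbl m + 1 := by rw [dbl_eq]; omega
    refine subsingleton_of_forall_eq 0 fun x => ?_
    obtain ⟨f, hf, rfl⟩ := cls_surj x
    rw [cls_eq_zero]
    exact abs_odd γ hord hsucc hex c hc hsum m f hf
end

section
variable (p : ℕ) [Fact p.Prime]

theorem mk_eq_iff (a b : ℚ) : (QuotientAddGroup.mk a : QModZ) = QuotientAddGroup.mk b ↔
    ∃ n : ℤ, (n : ℚ) = b - a := by
  rw [QuotientAddGroup.eq, AddSubgroup.mem_zmultiples_iff]
  simp [neg_add_eq_sub]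

theorem mk_nsmul (n : ℕ) (a : ℚ) :
    n • (QuotientAddGroup.mk a : QModZ) = QuotientAddGroup.mk (n * a) := by
  rw [← nsmul_eq_mul]; rfl

theorem mk_zsmul (n : ℤ) (a : ℚ) :
    n • (QuotientAddGroup.mk a : QModZ) = QuotientAddGroup.mk (n * a) := by
  rw [← zsmul_eq_mul]; rfl

theorem mk_inv_zero (k : ℕ) :
    p ^ k • (QuotientAddGroup.mk ((1 : ℚ) / p ^ k) : QModZ) = 0 := by
  have hp : (p : ℚ) ≠ 0 := by exact_mod_cast (Fact.out : p.Prime).ne_zero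
  rw [mk_nsmul, ← QuotientAddGroup.mk_zero, mk_eq_iff]
  refine ⟨-1, ?_⟩
  push_cast
  field_simp
  ring

def gam (k : ℕ) : Multiplicative (pruferSubgroup p) :=
  Multiplicative.ofAdd ⟨QuotientAddGroup.mk ((1 : ℚ) / p ^ (k+1)), k+1, mk_inv_zero p (k+1)⟩

noncomputable def sec (x : Multiplicative (pruferSubgroup p)) : ℚ :=
  Int.fract (Quotient.out ((Multiplicative.toAdd x : pruferSubgroup p) : QModZ))

theorem mk_sec (x : Multiplicative (pruferSubgroup p)) :
    (QuotientAddGroup.mk (sec p x) : QModZ) = ((Multiplicative.toAdd x : pruferSubgroup p) : QModZ) := by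
  conv_rhs => rw [← QuotientAddGroup.out_eq' ((Multiplicative.toAdd x : pruferSubgroup p) : QModZ)]
  rw [mk_eq_iff]
  refine ⟨⌊Quotient.out ((Multiplicative.toAdd x : pruferSubgroup p) : QModZ)⌋, ?_⟩
  have := Int.floor_add_fract (Quotient.out ((Multiplicative.toAdd x : pruferSubgroup p) : QModZ))
  rw [sec]
  linear_combination this

theorem sec_gam (k : ℕ) : sec p (gam p k) = 1 / p ^ (k+1) := by
  have h := mk_sec p (gam p k)
  have h2 : (QuotientAddGroup.mk (sec p (gam p k)) : QModZ) =
    QuotientAddGroup.mk ((1 : ℚ) / p ^ (k+1)) := h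
  rw [mk_eq_iff] at h2
  obtain ⟨n, hn⟩ := h2
  have hp : (1 : ℚ) < p := by exact_mod_cast (Fact.out : p.Prime).one_lt
  have h3 : Int.fract ((1 : ℚ) / p ^ (k+1)) = 1 / p ^ (k+1) := by
    rw [Int.fract_eq_self]
    refine ⟨by positivity, ?_⟩
    rw [div_lt_one (by positivity)]
    exact one_lt_pow₀ hp (by omega)
  have h4 : Int.fract (sec p (gam p k)) = sec p (gam p k) := by
    rw [sec, Int.fract_fract]
  rw [← h3, ← h4, Int.fract_eq_fract]
  exact ⟨-n, by push_cast; linear_combination hn⟩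

theorem carry_ex (x y : Multiplicative (pruferSubgroup p)) :
    ∃ n : ℤ, (n : ℚ) = sec p x + sec p y - sec p (x * y) := by
  rw [← mk_eq_iff, QuotientAddGroup.mk_add, mk_sec, mk_sec, mk_sec]
  rfl

noncomputable def carry (x y : Multiplicative (pruferSubgroup p)) : ℤ := (carry_ex p x y).choose

theorem carry_spec (x y : Multiplicative (pruferSubgroup p)) :
    (carry p x y : ℚ) = sec p x + sec p y - sec p (x * y) := (carry_ex p x y).choose_spec

theorem gam_pow (k : ℕ) : gam p k = gam p (k+1) ^ p := by
  have hp : (p : ℚ) ≠ 0 := by exact_mod_cast (Fact.out : p.Prime).ne_zero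
  apply Multiplicative.toAdd.injective
  apply Subtype.ext
  show (QuotientAddGroup.mk ((1 : ℚ) / p ^ (k+1)) : QModZ) =
    p • (QuotientAddGroup.mk ((1 : ℚ) / p ^ (k+1+1)) : QModZ)
  rw [mk_nsmul]
  congr 1
  field_simp
  ring

theorem gam_pow_one (k : ℕ) : gam p k ^ p ^ (k+1) = 1 := by
  apply Multiplicative.toAdd.injective
  apply Subtype.ext
  exact mk_inv_zero p (k+1)

theorem gam_ord (k : ℕ) : orderOf (gam p k) = p ^ (k+1) := by
  refine orderOf_eq_prime_pow ?_ (gam_pow_one p k)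
  intro h
  have hp : (p : ℚ) ≠ 0 := by exact_mod_cast (Fact.out : p.Prime).ne_zero
  have h1 : p ^ k • (QuotientAddGroup.mk ((1 : ℚ) / p ^ (k+1)) : QModZ) = QuotientAddGroup.mk 0 :=
    congrArg (fun x => ((Multiplicative.toAdd x : pruferSubgroup p) : QModZ)) h
  rw [mk_nsmul, mk_eq_iff] at h1
  obtain ⟨n, hn⟩ := h1
  have h2 : ((n * p : ℤ) : ℚ) = ((-1 : ℤ) : ℚ) := by
    push_cast at hn ⊢
    rw [hn]
    field_simp
    ring
  have h3 : n * p = -1 := by exact_mod_cast h2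
  have h4 : (p : ℤ) ∣ 1 := ⟨-n, by linear_combination h3⟩
  have h5 : p ∣ 1 := by exact_mod_cast h4
  exact (Fact.out : p.Prime).one_lt.ne' (Nat.dvd_one.1 h5)

theorem gam_ex (x : Multiplicative (pruferSubgroup p)) : ∃ k, x ∈ Subgroup.zpowers (gam p k) := by
  have hp : (p : ℚ) ≠ 0 := by exact_mod_cast (Fact.out : p.Prime).ne_zero
  obtain ⟨k, hk⟩ := (Multiplicative.toAdd x).2
  rw [← mk_sec, mk_nsmul, ← QuotientAddGroup.mk_zero, mk_eq_iff] at hk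
  obtain ⟨n, hn⟩ := hk
  refine ⟨k, -n * p, ?_⟩
  apply Multiplicative.toAdd.injective
  apply Subtype.ext
  rw [← mk_sec p x]
  show (-n * p : ℤ) • (QuotientAddGroup.mk ((1 : ℚ) / p ^ (k+1)) : QModZ) = _
  rw [mk_zsmul]
  congr 1
  push_cast at hn ⊢
  rw [hn]
  field_simp
  ring

theorem carry_sum (k : ℕ) :
    ∑ i ∈ Finset.range (p ^ (k+1)), carry p (gam p k ^ i) (gam p k) = 1 := by
  have hp : (p : ℚ) ≠ 0 := by exact_mod_cast (Fact.out : p.Prime).ne_zero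
  have : ((∑ i ∈ Finset.range (p ^ (k+1)), carry p (gam p k ^ i) (gam p k) : ℤ) : ℚ) = 1 := by
    push_cast
    have : ∀ i, (carry p (gam p k ^ i) (gam p k) : ℚ) =
        (sec p (gam p k ^ i) - sec p (gam p k ^ (i+1))) + 1 / p ^ (k+1) := by
      intro i; rw [carry_spec, sec_gam, pow_succ (gam p k) i]; abel
    rw [Finset.sum_congr rfl fun i _ => this i, Finset.sum_add_distrib,
      Finset.sum_range_sub' (fun i => sec p (gam p k ^ i)), gam_pow_one, pow_zero]
    simp
    try field_simp
  exact_mod_cast this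
end

/-- The group cohomology of the Prüfer `p`-group `Γ_∞` with coefficients in the trivial
representation on `ℤ_p` is `ℤ_p` in every even degree and `0` in every odd degree. -/
theorem groupCohomology_prufer_trivial (p : ℕ) [Fact p.Prime] :
    (∀ n : ℕ, Even n → Nonempty
      ((groupCohomology (Rep.trivial ℤ_[p] (Multiplicative (pruferSubgroup p)) ℤ_[p]) n)
        ≃ₗ[ℤ_[p]] ℤ_[p])) ∧
    (∀ n : ℕ, Odd n → Subsingleton
      (groupCohomology (Rep.trivial ℤ_[p] (Multiplicative (pruferSubgroup p)) ℤ_[p]) n)) := by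
  refine abs_main (gam p) (gam_ord p) ?_ (gam_ex p) (fun x y => (carry p x y : ℤ_[p])) ?_ ?_
  · intro k
    rw [gam_pow p k]
    exact Subgroup.npow_mem_zpowers _ _
  · intro a b z
    have : carry p b z - carry p (a * b) z + carry p a (b * z) - carry p a b = 0 := by
      have : ((carry p b z - carry p (a * b) z + carry p a (b * z) - carry p a b : ℤ) : ℚ) = 0 := by
        push_cast
        simp only [carry_spec, mul_assoc]
        ring
      exact_mod_cast this
    exact_mod_cast congrArg (Int.cast : ℤ → ℤ_[p]) this
  · intro k
    exact_mod_cast congrArg (Int.cast : ℤ → ℤ_[p]) (carry_sum p k)
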